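/- arXiv:1812.03472 — 9 statements merged into one kernel-verified Lean document; each statement's English description precedes it below -/
import Mathlib

section
/- Let E be a real inner product space, w, w̄ ∈ E, η ∈ ℝ, Ψ ≥ 0. Let X be a random vector in E with E[‖X‖⁴] < ∞, and let ε be a random sign with P(ε = 1) = P(ε = −1) = 1/2, independent of X. Define the label Y = ⟪X, w̄⟫ + εΨ and the updated hypothesis W' = w − 2η(⟪X, w⟫ − Y)X. Then E[‖w − w̄‖² − ‖W' − w̄‖²] = 4η·E[⟪X, w̄ − w⟫²] − 4η²·E[‖X‖²·⟪X, w̄ − w⟫²] − 4η²Ψ²·E[‖X‖²]. -/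
open MeasureTheory ProbabilityTheory
open scoped RealInnerProductSpace

section FairSign

variable {Ω : Type*} [MeasurableSpace Ω] {μ : Measure Ω} [IsProbabilityMeasure μ] {ε : Ω → ℝ}

theorem ae_eq_one_or_eq_neg_one_of_fair_sign (hε : Measurable ε)
    (h1 : μ {ω | ε ω = 1} = 1 / 2) (hm1 : μ {ω | ε ω = -1} = 1 / 2) :
    ∀ᵐ ω ∂μ, ε ω = 1 ∨ ε ω = -1 := by
  have hs1 : MeasurableSet {ω | ε ω = 1} := hε (measurableSet_singleton 1)
  have hsm1 : MeasurableSet {ω | ε ω = -1} := hε (measurableSet_singleton (-1))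
  have hd : Disjoint {ω | ε ω = 1} {ω | ε ω = -1} := by
    rw [Set.disjoint_left]
    intro ω (h : ε ω = 1) (h' : ε ω = -1)
    linarith
  have hu : μ ({ω | ε ω = 1} ∪ {ω | ε ω = -1}) = 1 := by
    rw [measure_union hd hsm1, h1, hm1, ENNReal.add_halves]
  exact (prob_compl_eq_zero_iff (hs1.union hsm1)).2 hu

theorem integral_fair_sign_eq_zero (hε : Measurable ε)
    (h1 : μ {ω | ε ω = 1} = 1 / 2) (hm1 : μ {ω | ε ω = -1} = 1 / 2) :
    ∫ ω, ε ω ∂μ = 0 := by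
  have hs1 : MeasurableSet {ω | ε ω = 1} := hε (measurableSet_singleton 1)
  have hsm1 : MeasurableSet {ω | ε ω = -1} := hε (measurableSet_singleton (-1))
  have hae : ε =ᵐ[μ] fun ω =>
      {ω | ε ω = 1}.indicator (fun _ => (1 : ℝ)) ω
        - {ω | ε ω = -1}.indicator (fun _ => (1 : ℝ)) ω := by
    filter_upwards [ae_eq_one_or_eq_neg_one_of_fair_sign hε h1 hm1] with ω hω
    rcases hω with h | h <;> simp only [Set.indicator, Set.mem_ofPred_eq, h] <;> norm_num
  rw [integral_congr_ae hae,
    integral_sub ((integrable_const 1).indicator hs1) ((integrable_const 1).indicator hsm1),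
    integral_indicator_const _ hs1, integral_indicator_const _ hsm1]
  simp [Measure.real, h1, hm1]

theorem integral_fair_sign_mul_eq_zero {E : Type*} [MeasurableSpace E] {X : Ω → E} {g : E → ℝ}
    (hε : Measurable ε) (h1 : μ {ω | ε ω = 1} = 1 / 2) (hm1 : μ {ω | ε ω = -1} = 1 / 2)
    (hind : IndepFun ε X μ) (hX : Measurable X) (hg : Measurable g) :
    ∫ ω, ε ω * g (X ω) ∂μ = 0 := by
  have h : IndepFun ε (fun ω => g (X ω)) μ := hind.comp measurable_id hg
  rw [h.integral_fun_mul_eq_mul_integral hε.aestronglyMeasurable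
    (hg.comp hX).aestronglyMeasurable, integral_fair_sign_eq_zero hε h1 hm1, zero_mul]

end FairSign

theorem sgd_step_norm_sq_decrease {E : Type*} [NormedAddCommGroup E] [InnerProductSpace ℝ E]
    (w wbar x : E) (η t : ℝ) :
    ‖w - wbar‖ ^ 2 - ‖w - (2 * η * (⟪x, w⟫ - (⟪x, wbar⟫ + t))) • x - wbar‖ ^ 2 =
      4 * η * (⟪x, wbar - w⟫ + t) * ⟪x, wbar - w⟫
        - 4 * η ^ 2 * (⟪x, wbar - w⟫ + t) ^ 2 * ‖x‖ ^ 2 := by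
  rw [sub_right_comm, norm_sub_sq_real (w - wbar), inner_smul_right, norm_smul, mul_pow,
    Real.norm_eq_abs, sq_abs, real_inner_comm x (w - wbar), inner_sub_right, inner_sub_right]
  ring

/-- Linear regression SGD step on a random example `X` with label
`Y = ⟪X, wbar⟫ + ε Ψ`, where `ε` is a fair random sign independent of `X`:
the expected convergence rate equals
`4η E[⟪X, wbar - w⟫²] - 4η² E[‖X‖² ⟪X, wbar - w⟫²] - 4η² Ψ² E[‖X‖²]`. -/
theorem stmt2 {E : Type*} [NormedAddCommGroup E] [InnerProductSpace ℝ E]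
    [MeasurableSpace E] [BorelSpace E]
    {Ω : Type*} [MeasureSpace Ω] [IsProbabilityMeasure (volume : Measure Ω)]
    (w wbar : E) (η Ψ : ℝ) (hΨ : 0 ≤ Ψ)
    (X : Ω → E) (ε : Ω → ℝ) (hX : Measurable X) (hε : Measurable ε)
    (hX4 : Integrable (fun ω => ‖X ω‖ ^ 4) volume)
    (hε1 : volume {ω | ε ω = 1} = 1 / 2)
    (hεm1 : volume {ω | ε ω = -1} = 1 / 2)
    (hind : IndepFun ε X volume) :
    ∫ ω, (‖w - wbar‖ ^ 2 -
        ‖w - (2 * η * (⟪X ω, w⟫ - (⟪X ω, wbar⟫ + ε ω * Ψ))) • X ω - wbar‖ ^ 2) =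
      4 * η * (∫ ω, ⟪X ω, wbar - w⟫ ^ 2)
        - 4 * η ^ 2 * (∫ ω, ‖X ω‖ ^ 2 * ⟪X ω, wbar - w⟫ ^ 2)
        - 4 * η ^ 2 * Ψ ^ 2 * (∫ ω, ‖X ω‖ ^ 2) := by
  have hin (v : E) : Measurable fun x : E => ⟪x, v⟫ :=
    (continuous_id.inner continuous_const).measurable
  have ha (x : E) : |⟪x, wbar - w⟫| ≤ ‖x‖ * ‖wbar - w‖ := abs_real_inner_le_norm _ _
  have hdom {f : Ω → ℝ} (hf : Measurable f) (C : ℝ) (hC : ∀ᵐ ω, |f ω| ≤ (1 + ‖X ω‖ ^ 4) * C) :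
      Integrable f :=
    (((integrable_const 1).add hX4).mul_const C).mono' hf.aestronglyMeasurable hC
  have hsq (x : E) : ‖x‖ ^ 2 ≤ 1 + ‖x‖ ^ 4 := by nlinarith [sq_nonneg (‖x‖ ^ 2 - 1)]
  have ha2 (x : E) : ⟪x, wbar - w⟫ ^ 2 ≤ ‖x‖ ^ 2 * ‖wbar - w‖ ^ 2 := by
    rw [← sq_abs, ← mul_pow]
    exact pow_le_pow_left₀ (abs_nonneg _) (ha x) 2
  have hi1 : Integrable fun ω => ⟪X ω, wbar - w⟫ ^ 2 := by
    refine hdom (((hin _).comp hX).pow_const 2) (‖wbar - w‖ ^ 2) (.of_forall fun ω => ?_)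
    rw [abs_of_nonneg (by positivity)]
    exact (ha2 _).trans (by gcongr; exact hsq _)
  have hi2 : Integrable fun ω => ‖X ω‖ ^ 2 * ⟪X ω, wbar - w⟫ ^ 2 := by
    refine hdom ((hX.norm.pow_const 2).mul (((hin _).comp hX).pow_const 2)) (‖wbar - w‖ ^ 2)
      (.of_forall fun ω => ?_)
    rw [abs_of_nonneg (by positivity)]
    nlinarith [mul_le_mul_of_nonneg_left (ha2 (X ω)) (sq_nonneg ‖X ω‖), sq_nonneg ‖wbar - w‖]
  have hi3 : Integrable fun ω => ‖X ω‖ ^ 2 := by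
    refine hdom (hX.norm.pow_const 2) 1 (.of_forall fun ω => ?_)
    rw [abs_of_nonneg (by positivity), mul_one]
    exact hsq _
  let g : E → ℝ := fun x => (4 * η * Ψ - 8 * η ^ 2 * Ψ * ‖x‖ ^ 2) * ⟪x, wbar - w⟫
  have hg : Measurable g :=
    ((measurable_norm.pow_const 2).const_mul _ |>.const_sub _).mul (hin _)
  have hsign := ae_eq_one_or_eq_neg_one_of_fair_sign hε hε1 hεm1
  have hi4 : Integrable fun ω => ε ω * g (X ω) := by
    refine hdom (hε.mul (hg.comp hX)) ((|4 * η * Ψ| + |8 * η ^ 2 * Ψ|) * ‖wbar - w‖) ?_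
    filter_upwards [hsign] with ω hω
    have hε_abs : |ε ω| = 1 := by rcases hω with h | h <;> simp [h]
    have hn := norm_nonneg (X ω)
    have hcub : ‖X ω‖ ^ 2 * ‖X ω‖ ≤ 1 + ‖X ω‖ ^ 4 := by
      nlinarith [sq_nonneg (‖X ω‖ ^ 2 - ‖X ω‖), hsq (X ω), sq_nonneg (‖X ω‖ ^ 2)]
    have hlin : ‖X ω‖ ≤ 1 + ‖X ω‖ ^ 4 := by
      nlinarith [sq_nonneg (‖X ω‖ - 1 / 2), sq_nonneg (‖X ω‖ ^ 2 - 1 / 2)]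
    calc |ε ω * g (X ω)|
        = |4 * η * Ψ - 8 * η ^ 2 * Ψ * ‖X ω‖ ^ 2| * |⟪X ω, wbar - w⟫| := by
          rw [abs_mul, hε_abs, one_mul, abs_mul]
      _ ≤ (|4 * η * Ψ| + |8 * η ^ 2 * Ψ| * ‖X ω‖ ^ 2) * (‖X ω‖ * ‖wbar - w‖) := by
          gcongr
          · refine (abs_sub _ _).trans_eq ?_
            rw [abs_mul (8 * η ^ 2 * Ψ), abs_of_nonneg (sq_nonneg ‖X ω‖)]
          · exact ha _
      _ = (|4 * η * Ψ| * ‖X ω‖ + |8 * η ^ 2 * Ψ| * (‖X ω‖ ^ 2 * ‖X ω‖)) * ‖wbar - w‖ := by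
          ring
      _ ≤ (|4 * η * Ψ| * (1 + ‖X ω‖ ^ 4) + |8 * η ^ 2 * Ψ| * (1 + ‖X ω‖ ^ 4))
            * ‖wbar - w‖ := by
          gcongr
      _ = (1 + ‖X ω‖ ^ 4) * ((|4 * η * Ψ| + |8 * η ^ 2 * Ψ|) * ‖wbar - w‖) := by
          ring
  have hae : (fun ω => ‖w - wbar‖ ^ 2 -
        ‖w - (2 * η * (⟪X ω, w⟫ - (⟪X ω, wbar⟫ + ε ω * Ψ))) • X ω - wbar‖ ^ 2) =ᵐ[volume]
      fun ω => 4 * η * ⟪X ω, wbar - w⟫ ^ 2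
        - 4 * η ^ 2 * (‖X ω‖ ^ 2 * ⟪X ω, wbar - w⟫ ^ 2)
        - 4 * η ^ 2 * Ψ ^ 2 * ‖X ω‖ ^ 2 + ε ω * g (X ω) := by
    filter_upwards [hsign] with ω hω
    have hε_sq : ε ω ^ 2 = 1 := by rcases hω with h | h <;> simp [h]
    rw [sgd_step_norm_sq_decrease]
    linear_combination (-(4 * η ^ 2 * Ψ ^ 2 * ‖X ω‖ ^ 2)) * hε_sq
  have hj1 := hi1.const_mul (4 * η)
  have hj2 := hi2.const_mul (4 * η ^ 2)
  have hj3 := hi3.const_mul (4 * η ^ 2 * Ψ ^ 2)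
  have hj12 : Integrable fun ω => 4 * η * ⟪X ω, wbar - w⟫ ^ 2
      - 4 * η ^ 2 * (‖X ω‖ ^ 2 * ⟪X ω, wbar - w⟫ ^ 2) := hj1.sub hj2
  have hj123 : Integrable fun ω => 4 * η * ⟪X ω, wbar - w⟫ ^ 2
      - 4 * η ^ 2 * (‖X ω‖ ^ 2 * ⟪X ω, wbar - w⟫ ^ 2)
      - 4 * η ^ 2 * Ψ ^ 2 * ‖X ω‖ ^ 2 := hj12.sub hj3
  rw [integral_congr_ae hae, integral_add hj123 hi4,
    integral_fair_sign_mul_eq_zero hε hε1 hεm1 hind hX hg, add_zero,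
    integral_sub hj12 hj3, integral_sub hj1 hj2, integral_const_mul,
    integral_const_mul, integral_const_mul]
end

section
/- Let E be a real inner product space, w, w̄ ∈ E, η > 0. Let X be a random vector in E with E[‖X‖⁴] < ∞, and let ε be a random sign with P(ε = 1) = P(ε = −1) = 1/2, independent of X. For Ψ ≥ 0, define the label Y_Ψ = ⟪X, w̄⟫ + εΨ, the updated hypothesis W'_Ψ = w − 2η(⟪X, w⟫ − Y_Ψ)X, and the expected convergence rate Δ(Ψ) = E[‖w − w̄‖² − ‖W'_Ψ − w̄‖²]. Then Δ is monotonically nonincreasing on [0, ∞); in fact Δ(Ψ₂) − Δ(Ψ₁) = −4η²(Ψ₂² − Ψ₁²)·E[‖X‖²] ≤ 0 for all 0 ≤ Ψ₁ ≤ Ψ₂, and Δ is strictly decreasing on [0, ∞) whenever E[‖X‖²] > 0. -/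
open MeasureTheory ProbabilityTheory
open scoped RealInnerProductSpace

lemma integrable_inner_pow_mul_norm_pow {Ω E : Type*} {mΩ : MeasurableSpace Ω} {μ : Measure Ω}
    [IsFiniteMeasure μ] [NormedAddCommGroup E] [InnerProductSpace ℝ E] [MeasurableSpace E]
    [BorelSpace E] {X : Ω → E} (hX : Measurable X) {n : ℕ}
    (hXn : Integrable (fun ω => ‖X ω‖ ^ n) μ) (u : E) {k l : ℕ} (hkl : k + l ≤ n) :
    Integrable (fun ω => ⟪X ω, u⟫ ^ k * ‖X ω‖ ^ l) μ := by
  have hm : Measurable (fun x : E => ⟪x, u⟫ ^ k * ‖x‖ ^ l) :=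
    Continuous.measurable (by fun_prop)
  refine (((integrable_const (1 : ℝ)).add hXn).const_mul (‖u‖ ^ k)).mono'
    (hm.comp hX).aestronglyMeasurable (Filter.Eventually.of_forall fun ω => ?_)
  have hpow : ‖X ω‖ ^ (k + l) ≤ 1 + ‖X ω‖ ^ n := by
    rcases le_total ‖X ω‖ 1 with h | h
    · have h1 := pow_le_one₀ (n := k + l) (norm_nonneg _) h
      have h2 : 0 ≤ ‖X ω‖ ^ n := by positivity
      linarith
    · have h1 := pow_le_pow_right₀ h hkl
      linarith
  calc ‖⟪X ω, u⟫ ^ k * ‖X ω‖ ^ l‖ = |⟪X ω, u⟫| ^ k * ‖X ω‖ ^ l := by simp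
    _ ≤ (‖X ω‖ * ‖u‖) ^ k * ‖X ω‖ ^ l := by
        gcongr
        exact abs_real_inner_le_norm _ _
    _ = ‖u‖ ^ k * ‖X ω‖ ^ (k + l) := by ring
    _ ≤ ‖u‖ ^ k * (1 + ‖X ω‖ ^ n) := by gcongr

section RandomSign

variable {Ω : Type*} {mΩ : MeasurableSpace Ω} {μ : Measure Ω} [IsProbabilityMeasure μ] {ε : Ω → ℝ}

lemma ae_eq_one_or_eq_neg_one_of_measure_eq_half (hε : Measurable ε)
    (hε1 : μ {ω | ε ω = 1} = 1 / 2) (hεm1 : μ {ω | ε ω = -1} = 1 / 2) :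
    ∀ᵐ ω ∂μ, ε ω = 1 ∨ ε ω = -1 := by
  have h1 : MeasurableSet {ω | ε ω = 1} := hε (measurableSet_singleton 1)
  have h2 : MeasurableSet {ω | ε ω = -1} := hε (measurableSet_singleton (-1))
  have hd : Disjoint {ω | ε ω = 1} {ω | ε ω = -1} := by
    refine Set.disjoint_left.2 fun ω (h : ε ω = 1) (h' : ε ω = -1) => ?_
    linarith
  have hu : μ ({ω | ε ω = 1} ∪ {ω | ε ω = -1}) = 1 := by
    rw [measure_union hd h2, hε1, hεm1, ENNReal.add_halves]
  exact (mem_ae_iff_prob_eq_one (h1.union h2)).2 hu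

lemma integral_eq_zero_of_measure_eq_half (hε : Measurable ε)
    (hε1 : μ {ω | ε ω = 1} = 1 / 2) (hεm1 : μ {ω | ε ω = -1} = 1 / 2) :
    ∫ ω, ε ω ∂μ = 0 := by
  have h1 : MeasurableSet {ω | ε ω = 1} := hε (measurableSet_singleton 1)
  have h2 : MeasurableSet {ω | ε ω = -1} := hε (measurableSet_singleton (-1))
  have h : ε =ᵐ[μ] fun ω => {ω | ε ω = 1}.indicator (fun _ => (1 : ℝ)) ω -
      {ω | ε ω = -1}.indicator (fun _ => (1 : ℝ)) ω := by
    filter_upwards [ae_eq_one_or_eq_neg_one_of_measure_eq_half hε hε1 hεm1] with ω hω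
    rcases hω with hω | hω <;> simp only [Set.indicator, Set.mem_ofPred_eq, hω] <;> norm_num
  rw [integral_congr_ae h, integral_sub ((integrable_const _).indicator h1)
    ((integrable_const _).indicator h2), integral_indicator_const _ h1,
    integral_indicator_const _ h2, measureReal_def, measureReal_def, hε1, hεm1, sub_self]

end RandomSign

lemma norm_sq_sub_norm_sgd_step_sq {E : Type*} [NormedAddCommGroup E] [InnerProductSpace ℝ E]
    (w wbar x : E) (η e : ℝ) :
    ‖w - wbar‖ ^ 2 - ‖w - (2 * η * (⟪x, w⟫ - (⟪x, wbar⟫ + e))) • x - wbar‖ ^ 2 =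
      4 * η * (⟪x, w - wbar⟫ - e) * ⟪x, w - wbar⟫ -
        4 * η ^ 2 * (⟪x, w - wbar⟫ - e) ^ 2 * ‖x‖ ^ 2 := by
  have h : w - (2 * η * (⟪x, w⟫ - (⟪x, wbar⟫ + e))) • x - wbar =
      (w - wbar) - (2 * η * (⟪x, w - wbar⟫ - e)) • x := by
    rw [inner_sub_right, sub_right_comm]
    congr 3
    ring
  rw [h, norm_sub_sq_real (w - wbar), inner_smul_right, norm_smul, mul_pow, Real.norm_eq_abs, sq_abs,
    real_inner_comm x (w - wbar)]
  ring

/-- In the linear regression SGD setting with random sign labels,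
the expected convergence rate `Δ(Ψ)` is monotonically nonincreasing in the difficulty
score `Ψ ≥ 0`: in fact `Δ(Ψ₂) - Δ(Ψ₁) = -4η²(Ψ₂² - Ψ₁²) E[‖X‖²] ≤ 0` for
`0 ≤ Ψ₁ ≤ Ψ₂`, and `Δ` is strictly decreasing on `[0, ∞)` whenever `E[‖X‖²] > 0`. -/
theorem stmt3 {E : Type*} [NormedAddCommGroup E] [InnerProductSpace ℝ E]
    [MeasurableSpace E] [BorelSpace E]
    {Ω : Type*} [MeasureSpace Ω] [IsProbabilityMeasure (volume : Measure Ω)]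
    (w wbar : E) (η : ℝ) (hη : 0 < η)
    (X : Ω → E) (ε : Ω → ℝ) (hX : Measurable X) (hε : Measurable ε)
    (hX4 : Integrable (fun ω => ‖X ω‖ ^ 4) volume)
    (hε1 : volume {ω | ε ω = 1} = 1 / 2)
    (hεm1 : volume {ω | ε ω = -1} = 1 / 2)
    (hind : IndepFun ε X volume)
    (Δ : ℝ → ℝ)
    (hΔ : ∀ Ψ : ℝ, Δ Ψ = ∫ ω, (‖w - wbar‖ ^ 2 -
        ‖w - (2 * η * (⟪X ω, w⟫ - (⟪X ω, wbar⟫ + ε ω * Ψ))) • X ω - wbar‖ ^ 2)) :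
    (∀ Ψ₁ Ψ₂ : ℝ, 0 ≤ Ψ₁ → Ψ₁ ≤ Ψ₂ →
        Δ Ψ₂ - Δ Ψ₁ = -(4 * η ^ 2) * (Ψ₂ ^ 2 - Ψ₁ ^ 2) * (∫ ω, ‖X ω‖ ^ 2) ∧
        Δ Ψ₂ ≤ Δ Ψ₁) ∧
      ((0 < ∫ ω, ‖X ω‖ ^ 2) → StrictAntiOn Δ (Set.Ici 0)) := by
  have hpow := fun {k l : ℕ} (hkl : k + l ≤ 4) =>
    integrable_inner_pow_mul_norm_pow hX hX4 (w - wbar) hkl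
  have hn : Integrable (fun ω => ‖X ω‖ ^ 2) := by
    simpa using hpow (k := 0) (l := 2) (by norm_num)
  have hsign := ae_eq_one_or_eq_neg_one_of_measure_eq_half hε hε1 hεm1
  let F : E → ℝ := fun x => 4 * η * (⟪x, w - wbar⟫ ^ 2 * ‖x‖ ^ 0) -
    4 * η ^ 2 * (⟪x, w - wbar⟫ ^ 2 * ‖x‖ ^ 2)
  let G : E → ℝ := fun x => 8 * η ^ 2 * (⟪x, w - wbar⟫ ^ 1 * ‖x‖ ^ 2) -
    4 * η * (⟪x, w - wbar⟫ ^ 1 * ‖x‖ ^ 0)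
  have hF : Integrable (fun ω => F (X ω)) :=
    ((hpow (by norm_num)).const_mul _).sub ((hpow (by norm_num)).const_mul _)
  have hG : Integrable (fun ω => G (X ω)) :=
    ((hpow (by norm_num)).const_mul _).sub ((hpow (by norm_num)).const_mul _)
  have hGm : Measurable G := Continuous.measurable (by fun_prop)
  have hεG : Integrable (fun ω => ε ω * G (X ω)) := by
    refine hG.bdd_mul (c := 1) hε.aestronglyMeasurable ?_
    filter_upwards [hsign] with ω hω
    rcases hω with hω | hω <;> simp [hω]
  have hεG0 : ∫ ω, ε ω * G (X ω) = 0 := by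
    have h := (hind.comp measurable_id hGm).integral_fun_mul_eq_mul_integral
      hε.aestronglyMeasurable (hGm.comp hX).aestronglyMeasurable
    simpa [integral_eq_zero_of_measure_eq_half hε hε1 hεm1] using h
  have hΔ_eq (Ψ : ℝ) :
      Δ Ψ = (∫ ω, F (X ω)) - 4 * η ^ 2 * Ψ ^ 2 * ∫ ω, ‖X ω‖ ^ 2 := by
    have hae : (fun ω => ‖w - wbar‖ ^ 2 -
        ‖w - (2 * η * (⟪X ω, w⟫ - (⟪X ω, wbar⟫ + ε ω * Ψ))) • X ω - wbar‖ ^ 2) =ᵐ[volume]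
        fun ω => F (X ω) + Ψ * (ε ω * G (X ω)) - 4 * η ^ 2 * Ψ ^ 2 * ‖X ω‖ ^ 2 := by
      filter_upwards [hsign] with ω hω
      rw [norm_sq_sub_norm_sgd_step_sq]
      simp only [F, G]
      rcases hω with hω | hω <;> rw [hω] <;> ring
    have hFG : Integrable (fun ω => F (X ω) + Ψ * (ε ω * G (X ω))) := hF.add (hεG.const_mul Ψ)
    rw [hΔ, integral_congr_ae hae, integral_sub hFG (hn.const_mul _),
      integral_add hF (hεG.const_mul Ψ), integral_const_mul, integral_const_mul, hεG0]
    ring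
  have hdiff (Ψ₁ Ψ₂ : ℝ) :
      Δ Ψ₂ - Δ Ψ₁ = -(4 * η ^ 2) * (Ψ₂ ^ 2 - Ψ₁ ^ 2) * ∫ ω, ‖X ω‖ ^ 2 := by
    rw [hΔ_eq, hΔ_eq]
    ring
  refine ⟨fun Ψ₁ Ψ₂ h1 h12 => ⟨hdiff Ψ₁ Ψ₂, ?_⟩, fun hpos Ψ₁ h1 Ψ₂ _ h12 => ?_⟩
  · have hsq : 0 ≤ Ψ₂ ^ 2 - Ψ₁ ^ 2 := sub_nonneg.2 (pow_le_pow_left₀ h1 h12 2)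
    have hI : 0 ≤ ∫ ω, ‖X ω‖ ^ 2 := integral_nonneg fun ω => by positivity
    have hprod : 0 ≤ 4 * η ^ 2 * (Ψ₂ ^ 2 - Ψ₁ ^ 2) * ∫ ω, ‖X ω‖ ^ 2 := by positivity
    linarith [hdiff Ψ₁ Ψ₂]
  · have hsq : 0 < Ψ₂ ^ 2 - Ψ₁ ^ 2 :=
      sub_pos.2 (pow_lt_pow_left₀ h12 (Set.mem_Ici.1 h1) two_ne_zero)
    have hprod : 0 < 4 * η ^ 2 * (Ψ₂ ^ 2 - Ψ₁ ^ 2) * ∫ ω, ‖X ω‖ ^ 2 := by positivity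
    linarith [hdiff Ψ₁ Ψ₂]
end

section
/- Let E be a real inner product space, w̄ ∈ E, u ∈ E a unit vector, Ψ ≥ 0, η > 0. Let X be a random vector in E with E[‖X‖⁴] < ∞ and E[‖X‖²⟪X, u⟫²] > 0, and let ε be a random sign with P(ε = 1) = P(ε = −1) = 1/2, independent of X. For λ ≥ 0, let w_λ = w̄ − λu, define the label Y = ⟪X, w̄⟫ + εΨ, the updated hypothesis W'_λ = w_λ − 2η(⟪X, w_λ⟫ − Y)X, and Δ(λ) = E[‖w_λ − w̄‖² − ‖W'_λ − w̄‖²]. If η ≤ E[⟪X, u⟫²] / E[‖X‖²⟪X, u⟫²], then Δ is monotonically nondecreasing in λ on [0, ∞). -/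
open MeasureTheory ProbabilityTheory
open scoped RealInnerProductSpace

/-- A random sign equals `1` or `-1` almost surely. -/
theorem ae_eq_one_or_neg_one_of_measure_eq_half {Ω : Type*} [MeasurableSpace Ω] {μ : Measure Ω}
    [IsProbabilityMeasure μ] {ε : Ω → ℝ} (hε : Measurable ε)
    (h1 : μ {ω | ε ω = 1} = 1 / 2) (hm1 : μ {ω | ε ω = -1} = 1 / 2) :
    ∀ᵐ ω ∂μ, ε ω = 1 ∨ ε ω = -1 := by
  have hm : MeasurableSet {ω | ε ω = 1} := hε (measurableSet_singleton 1)
  have hm' : MeasurableSet {ω | ε ω = -1} := hε (measurableSet_singleton (-1))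
  have hd : Disjoint {ω | ε ω = 1} {ω | ε ω = -1} := by
    rw [Set.disjoint_left]
    intro ω h h'
    simp only [Set.mem_ofPred_eq] at h h'
    linarith
  have hu : μ ({ω | ε ω = 1} ∪ {ω | ε ω = -1}) = 1 := by
    rw [measure_union hd hm', h1, hm1, ENNReal.add_halves]
  exact (mem_ae_iff_prob_eq_one (hm.union hm')).2 hu

/-- A random sign has mean zero. -/
theorem integral_eq_zero_of_measure_eq_half_s4 {Ω : Type*} [MeasurableSpace Ω] {μ : Measure Ω}
    [IsProbabilityMeasure μ] {ε : Ω → ℝ} (hε : Measurable ε)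
    (h1 : μ {ω | ε ω = 1} = 1 / 2) (hm1 : μ {ω | ε ω = -1} = 1 / 2) :
    ∫ ω, ε ω ∂μ = 0 := by
  have hm : MeasurableSet {ω | ε ω = 1} := hε (measurableSet_singleton 1)
  have hm' : MeasurableSet {ω | ε ω = -1} := hε (measurableSet_singleton (-1))
  have hae : ε =ᵐ[μ] fun ω => {ω | ε ω = 1}.indicator (fun _ => (1 : ℝ)) ω -
      {ω | ε ω = -1}.indicator (fun _ => (1 : ℝ)) ω := by
    filter_upwards [ae_eq_one_or_neg_one_of_measure_eq_half hε h1 hm1] with ω h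
    rcases h with h | h <;> norm_num [Set.indicator, h]
  rw [integral_congr_ae hae, integral_sub ((integrable_const 1).indicator hm)
    ((integrable_const 1).indicator hm'), integral_indicator_const _ hm,
    integral_indicator_const _ hm', measureReal_def, measureReal_def, h1, hm1, sub_self]

/-- Pointwise expansion of the decrease of the squared distance in one gradient step, for a
label whose sign `e` satisfies `e ^ 2 = 1`. -/
theorem norm_sq_sub_norm_sq_sgd_step {E : Type*} [NormedAddCommGroup E] [InnerProductSpace ℝ E]
    (wbar u x : E) (hu : ‖u‖ = 1) (Ψ η lam e : ℝ) (he : e ^ 2 = 1) :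
    ‖(wbar - lam • u) - wbar‖ ^ 2 - ‖(wbar - lam • u) -
        (2 * η * (⟪x, wbar - lam • u⟫ - (⟪x, wbar⟫ + e * Ψ))) • x - wbar‖ ^ 2 =
      lam ^ 2 * (4 * η * (⟪x, u⟫ ^ 2 - η * (‖x‖ ^ 2 * ⟪x, u⟫ ^ 2))) +
        lam * (e * (4 * η * Ψ * (⟪x, u⟫ - 2 * η * (‖x‖ ^ 2 * ⟪x, u⟫)))) -
        4 * η ^ 2 * Ψ ^ 2 * ‖x‖ ^ 2 := by
  have h1 : (wbar - lam • u) - wbar = -(lam • u) := by abel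
  have h2 : (wbar - lam • u) -
      (2 * η * (⟪x, wbar - lam • u⟫ - (⟪x, wbar⟫ + e * Ψ))) • x - wbar =
      (2 * η * (lam * ⟪x, u⟫ + e * Ψ)) • x - lam • u := by
    rw [inner_sub_right, real_inner_smul_right]
    module
  rw [h1, h2, norm_neg, norm_sub_sq_real, real_inner_smul_left, real_inner_smul_right,
    norm_smul, norm_smul, hu, mul_pow, mul_pow, Real.norm_eq_abs, Real.norm_eq_abs, sq_abs,
    sq_abs]
  linear_combination (-4 * η ^ 2 * Ψ ^ 2 * ‖x‖ ^ 2) * he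

/-- A measurable function bounded by a power of order at most four of the norm of `X` is
integrable as soon as `X` has a fourth moment. -/
theorem integrable_of_abs_le_norm_pow {E Ω : Type*} [NormedAddCommGroup E] [MeasurableSpace Ω]
    {μ : Measure Ω} [IsFiniteMeasure μ] {X : Ω → E} (hX4 : Integrable (fun ω => ‖X ω‖ ^ 4) μ)
    {f : Ω → ℝ} (hf : Measurable f) {k : ℕ} (hk : k ≤ 4) (h : ∀ ω, |f ω| ≤ ‖X ω‖ ^ k) :
    Integrable f μ := by
  refine ((integrable_const (1 : ℝ)).add hX4).mono' hf.aestronglyMeasurable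
    (Filter.Eventually.of_forall fun ω => (h ω).trans ?_)
  simp only [Pi.add_apply]
  rcases le_total ‖X ω‖ 1 with h1 | h1
  · have := pow_le_one₀ (n := k) (norm_nonneg (X ω)) h1
    have := pow_nonneg (norm_nonneg (X ω)) 4
    linarith
  · have := pow_le_pow_right₀ h1 hk
    linarith

/-- In the linear regression SGD setting with random sign labels and
current hypothesis `w_λ = wbar - λ u` (with `u` a unit vector), if the learning rate
satisfies `η ≤ E[⟪X, u⟫²] / E[‖X‖² ⟪X, u⟫²]`, then the expected convergence rate
`Δ(λ)` is monotonically nondecreasing in `λ` on `[0, ∞)`. -/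
theorem stmt4 {E : Type*} [NormedAddCommGroup E] [InnerProductSpace ℝ E]
    [MeasurableSpace E] [BorelSpace E]
    {Ω : Type*} [MeasureSpace Ω] [IsProbabilityMeasure (volume : Measure Ω)]
    (wbar : E) (u : E) (hu : ‖u‖ = 1) (Ψ η : ℝ) (hΨ : 0 ≤ Ψ) (hη : 0 < η)
    (X : Ω → E) (ε : Ω → ℝ) (hX : Measurable X) (hε : Measurable ε)
    (hX4 : Integrable (fun ω => ‖X ω‖ ^ 4) volume)
    (hXu : 0 < ∫ ω, ‖X ω‖ ^ 2 * ⟪X ω, u⟫ ^ 2)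
    (hε1 : volume {ω | ε ω = 1} = 1 / 2)
    (hεm1 : volume {ω | ε ω = -1} = 1 / 2)
    (hind : IndepFun ε X volume)
    (Δ : ℝ → ℝ)
    (hΔ : ∀ lam : ℝ, Δ lam = ∫ ω, (‖(wbar - lam • u) - wbar‖ ^ 2 -
        ‖(wbar - lam • u) -
          (2 * η * (⟪X ω, wbar - lam • u⟫ - (⟪X ω, wbar⟫ + ε ω * Ψ))) • X ω - wbar‖ ^ 2))
    (hηle : η ≤ (∫ ω, ⟪X ω, u⟫ ^ 2) / (∫ ω, ‖X ω‖ ^ 2 * ⟪X ω, u⟫ ^ 2)) :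
    MonotoneOn Δ (Set.Ici 0) := by
  have hmu : Measurable fun x : E => ⟪x, u⟫ := by
    have : Continuous fun x : E => ⟪x, u⟫ := by fun_prop
    exact this.measurable
  have hma : Measurable fun ω => ⟪X ω, u⟫ := hmu.comp hX
  have hmn : Measurable fun ω => ‖X ω‖ := measurable_norm.comp hX
  have hle : ∀ ω, |⟪X ω, u⟫| ≤ ‖X ω‖ := fun ω => by
    simpa [hu] using abs_real_inner_le_norm (X ω) u
  have hle2 : ∀ ω, ⟪X ω, u⟫ ^ 2 ≤ ‖X ω‖ ^ 2 := fun ω =>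
    sq_le_sq.2 (by simpa using hle ω)
  have ia : Integrable fun ω => ⟪X ω, u⟫ :=
    integrable_of_abs_le_norm_pow hX4 hma (k := 1) (by norm_num) (by simpa using hle)
  have ia2 : Integrable fun ω => ⟪X ω, u⟫ ^ 2 :=
    integrable_of_abs_le_norm_pow hX4 (hma.pow_const 2) (k := 2) (by norm_num)
      (by simpa using hle2)
  have is2 : Integrable fun ω => ‖X ω‖ ^ 2 :=
    integrable_of_abs_le_norm_pow hX4 (hmn.pow_const 2) (k := 2) (by norm_num) (by simp)
  have isa : Integrable fun ω => ‖X ω‖ ^ 2 * ⟪X ω, u⟫ :=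
    integrable_of_abs_le_norm_pow hX4 ((hmn.pow_const 2).mul hma) (k := 3) (by norm_num)
      fun ω => by
        rw [abs_mul, abs_of_nonneg (by positivity), pow_succ ‖X ω‖ 2]
        exact mul_le_mul_of_nonneg_left (hle ω) (by positivity)
  have isa2 : Integrable fun ω => ‖X ω‖ ^ 2 * ⟪X ω, u⟫ ^ 2 :=
    integrable_of_abs_le_norm_pow hX4 ((hmn.pow_const 2).mul (hma.pow_const 2)) (k := 4) le_rfl
      fun ω => by
        rw [abs_of_nonneg (by positivity), show 4 = 2 + 2 from rfl, pow_add]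
        exact mul_le_mul_of_nonneg_left (hle2 ω) (by positivity)
  have hsign := ae_eq_one_or_neg_one_of_measure_eq_half hε hε1 hεm1
  let g : E → ℝ := fun x => 4 * η * Ψ * (⟪x, u⟫ - 2 * η * (‖x‖ ^ 2 * ⟪x, u⟫))
  have hg : Measurable g :=
    (hmu.sub (((measurable_norm.pow_const 2).mul hmu).const_mul (2 * η))).const_mul (4 * η * Ψ)
  have ig : Integrable fun ω => g (X ω) := (ia.sub (isa.const_mul (2 * η))).const_mul (4 * η * Ψ)
  have ieg : Integrable fun ω => ε ω * g (X ω) := by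
    refine ig.mono (hε.mul (hg.comp hX)).aestronglyMeasurable ?_
    filter_upwards [hsign] with ω h
    rcases h with h | h <;> simp [h]
  have heg : ∫ ω, ε ω * g (X ω) = 0 := by
    have hi : IndepFun ε (fun ω => g (X ω)) volume := hind.comp measurable_id hg
    rw [hi.integral_fun_mul_eq_mul_integral hε.aestronglyMeasurable
      (hg.comp hX).aestronglyMeasurable, integral_eq_zero_of_measure_eq_half_s4 hε hε1 hεm1, zero_mul]
  have iC : Integrable fun ω => 4 * η * (⟪X ω, u⟫ ^ 2 - η * (‖X ω‖ ^ 2 * ⟪X ω, u⟫ ^ 2)) :=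
    (ia2.sub (isa2.const_mul η)).const_mul (4 * η)
  have hΔ' : ∀ lam, Δ lam = lam ^ 2 * (4 * η * ((∫ ω, ⟪X ω, u⟫ ^ 2) -
      η * ∫ ω, ‖X ω‖ ^ 2 * ⟪X ω, u⟫ ^ 2)) - 4 * η ^ 2 * Ψ ^ 2 * ∫ ω, ‖X ω‖ ^ 2 := by
    intro lam
    have hae : ∀ᵐ ω, ‖(wbar - lam • u) - wbar‖ ^ 2 - ‖(wbar - lam • u) -
          (2 * η * (⟪X ω, wbar - lam • u⟫ - (⟪X ω, wbar⟫ + ε ω * Ψ))) • X ω - wbar‖ ^ 2 =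
        lam ^ 2 * (4 * η * (⟪X ω, u⟫ ^ 2 - η * (‖X ω‖ ^ 2 * ⟪X ω, u⟫ ^ 2))) +
          lam * (ε ω * g (X ω)) - 4 * η ^ 2 * Ψ ^ 2 * ‖X ω‖ ^ 2 := by
      filter_upwards [hsign] with ω h
      exact norm_sq_sub_norm_sq_sgd_step wbar u (X ω) hu Ψ η lam (ε ω) (by
        rcases h with h | h <;> norm_num [h])
    have iCg : Integrable fun ω =>
        lam ^ 2 * (4 * η * (⟪X ω, u⟫ ^ 2 - η * (‖X ω‖ ^ 2 * ⟪X ω, u⟫ ^ 2))) +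
          lam * (ε ω * g (X ω)) :=
      (iC.const_mul _).add (ieg.const_mul _)
    rw [hΔ, integral_congr_ae hae, integral_sub iCg (is2.const_mul _),
      integral_add (iC.const_mul _) (ieg.const_mul _), integral_const_mul, integral_const_mul,
      integral_const_mul, integral_const_mul, heg, integral_sub ia2 (isa2.const_mul η),
      integral_const_mul]
    ring
  have hnonneg : 0 ≤ (∫ ω, ⟪X ω, u⟫ ^ 2) - η * ∫ ω, ‖X ω‖ ^ 2 * ⟪X ω, u⟫ ^ 2 :=
    sub_nonneg.2 ((le_div_iff₀ hXu).1 hηle)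
  intro a ha b _ hab
  rw [hΔ', hΔ']
  have hab2 : a ^ 2 ≤ b ^ 2 := pow_le_pow_left₀ ha hab 2
  gcongr
end

section
/- Let E be a real inner product space, w̄ ∈ E, η > 0. Let X be a random vector in E with 0 < E[‖X‖²] < ∞, and let ε be a random sign with P(ε = 1) = P(ε = −1) = 1/2, independent of X. Suppose the current hypothesis equals the optimal one, w = w̄. For Υ ≥ 0, define the label Y = ⟪X, w̄⟫ + εΥ and the updated hypothesis W' = w̄ − 2η(⟪X, w̄⟫ − Y)X. Then the expected convergence rate satisfies E[‖w̄ − w̄‖² − ‖W' − w̄‖²] = −4η²Υ²·E[‖X‖²]; in particular it is negative for Υ > 0 and strictly decreasing as a function of Υ on [0, ∞). (Hence at hypotheses at, or sufficiently near, the optimum the expected convergence rate decreases with the local difficulty.) -/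
open MeasureTheory ProbabilityTheory
open scoped RealInnerProductSpace

/-- A random variable taking each of the values `1` and `-1` with probability `1 / 2` has
square almost surely equal to `1`. -/
theorem ae_sq_eq_one_of_random_sign {Ω : Type*} [MeasurableSpace Ω] {μ : Measure Ω}
    [IsProbabilityMeasure μ] {ε : Ω → ℝ} (hε : Measurable ε)
    (h₁ : μ {ω | ε ω = 1} = 1 / 2) (h₂ : μ {ω | ε ω = -1} = 1 / 2) :
    ∀ᵐ ω ∂μ, ε ω ^ 2 = 1 := by
  have hm₁ : MeasurableSet {ω | ε ω = 1} := hε (measurableSet_singleton 1)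
  have hm₂ : MeasurableSet {ω | ε ω = -1} := hε (measurableSet_singleton (-1))
  have hdisj : Disjoint {ω | ε ω = 1} {ω | ε ω = -1} := by
    rw [Set.disjoint_left]
    intro ω (h : ε ω = 1) (h' : ε ω = -1)
    linarith
  have hunion : μ ({ω | ε ω = 1} ∪ {ω | ε ω = -1}) = 1 := by
    rw [measure_union hdisj hm₂, h₁, h₂, ENNReal.add_halves]
  filter_upwards [(mem_ae_iff_prob_eq_one (hm₁.union hm₂)).2 hunion] with ω hω
  rcases hω with (h : ε ω = 1) | (h : ε ω = -1) <;> simp [h]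

/-- (Theorem 3 of the paper, at the optimum.) When the current
hypothesis equals the optimal one `wbar`, the expected convergence rate for local
difficulty `Υ` equals `-4η²Υ² E[‖X‖²]`; in particular it is negative for `Υ > 0`
and strictly decreasing in `Υ` on `[0, ∞)`. -/
theorem stmt10 {E : Type*} [NormedAddCommGroup E] [InnerProductSpace ℝ E]
    [MeasurableSpace E] [BorelSpace E]
    {Ω : Type*} [MeasureSpace Ω] [IsProbabilityMeasure (volume : Measure Ω)]
    (wbar : E) (η : ℝ) (hη : 0 < η)
    (X : Ω → E) (ε : Ω → ℝ) (hX : Measurable X) (hε : Measurable ε)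
    (hX2 : Integrable (fun ω => ‖X ω‖ ^ 2) volume)
    (hX2pos : 0 < ∫ ω, ‖X ω‖ ^ 2)
    (hε1 : volume {ω | ε ω = 1} = 1 / 2)
    (hεm1 : volume {ω | ε ω = -1} = 1 / 2)
    (hind : IndepFun ε X volume)
    (Δ : ℝ → ℝ)
    (hΔ : ∀ Υ : ℝ, Δ Υ = ∫ ω, (‖wbar - wbar‖ ^ 2 -
        ‖wbar - (2 * η * (⟪X ω, wbar⟫ - (⟪X ω, wbar⟫ + ε ω * Υ))) • X ω - wbar‖ ^ 2)) :
    (∀ Υ : ℝ, 0 ≤ Υ → Δ Υ = -(4 * η ^ 2 * Υ ^ 2) * ∫ ω, ‖X ω‖ ^ 2) ∧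
    (∀ Υ : ℝ, 0 < Υ → Δ Υ < 0) ∧
    StrictAntiOn Δ (Set.Ici 0) := by
  have formula (Υ : ℝ) : Δ Υ = -(4 * η ^ 2 * Υ ^ 2) * ∫ ω, ‖X ω‖ ^ 2 := by
    rw [hΔ, ← integral_const_mul]
    refine integral_congr_ae ?_
    filter_upwards [ae_sq_eq_one_of_random_sign hε hε1 hεm1] with ω hω
    rw [sub_self, norm_zero, sub_right_comm, sub_self, zero_sub, norm_neg, norm_smul, mul_pow,
      Real.norm_eq_abs, sq_abs]
    linear_combination (-(4 * η ^ 2 * Υ ^ 2 * ‖X ω‖ ^ 2)) * hω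
  refine ⟨fun Υ _ => formula Υ, fun Υ hΥ => ?_, fun a ha b _ hab => ?_⟩
  · rw [formula, neg_mul, neg_lt_zero]
    positivity
  · rw [formula, formula]
    have hsq : a ^ 2 < b ^ 2 := pow_lt_pow_left₀ hab ha two_ne_zero
    gcongr
end

section
/- Let E be a real inner product space, let w̄, w_t ∈ E be unit vectors, M > 0, and let X be a random vector in E with ‖X‖ ≤ M almost surely. For η with |η| < 1/M, define Δ(η) = E[ 1_{⟪X, w_t⟫ ≤ 1} · ( ⟪w_t + ηX, w̄⟫/‖w_t + ηX‖ − ⟪w_t, w̄⟫ ) ]. Then Δ is differentiable at η = 0 with Δ'(0) = E[ 1_{⟪X, w_t⟫ ≤ 1} · ( ⟪X, w̄⟫ − ⟪X, w_t⟫·⟪w_t, w̄⟫ ) ]. -/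
open MeasureTheory
open scoped RealInnerProductSpace

/-- The derivative in `η` of the inner product of the normalization of `w + η • x` with `u`. -/
theorem hasDerivAt_inner_div_norm_add_smul {E : Type*} [NormedAddCommGroup E]
    [InnerProductSpace ℝ E] (w x u : E) (η : ℝ) (hv : w + η • x ≠ 0) :
    HasDerivAt (fun η : ℝ => ⟪w + η • x, u⟫ / ‖w + η • x‖)
      (⟪x, u⟫ / ‖w + η • x‖ - ⟪w + η • x, u⟫ * ⟪w + η • x, x⟫ / ‖w + η • x‖ ^ 3) η := by
  have hline : HasDerivAt (fun η : ℝ => w + η • x) x η := by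
    simpa using ((hasDerivAt_id η).smul_const x).const_add w
  have hinner : HasDerivAt (fun η : ℝ => ⟪w + η • x, u⟫) ⟪x, u⟫ η := by
    simpa using hline.inner ℝ (hasDerivAt_const η u)
  have hpos : ‖w + η • x‖ ≠ 0 := norm_ne_zero_iff.2 hv
  have hnorm : HasDerivAt (fun η : ℝ => ‖w + η • x‖)
      (⟪w + η • x, x⟫ / ‖w + η • x‖) η := by
    have h := hline.norm_sq.sqrt (pow_ne_zero 2 hpos)
    simp only [Real.sqrt_sq (norm_nonneg _)] at h
    refine h.congr_deriv ?_
    field_simp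
  refine (hinner.fun_div hnorm hpos).congr_deriv ?_
  field_simp

theorem abs_inner_div_sub_le {E : Type*} [NormedAddCommGroup E]
    [InnerProductSpace ℝ E] (v x u : E) (hu : ‖u‖ = 1) (hv : 1 / 2 ≤ ‖v‖) :
    |⟪x, u⟫ / ‖v‖ - ⟪v, u⟫ * ⟪v, x⟫ / ‖v‖ ^ 3| ≤ 4 * ‖x‖ := by
  have hpos : 0 < ‖v‖ := by linarith
  have hxu : |⟪x, u⟫| ≤ ‖x‖ := by simpa [hu] using abs_real_inner_le_norm x u
  have hvu : |⟪v, u⟫| ≤ ‖v‖ := by simpa [hu] using abs_real_inner_le_norm v u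
  have hvx : |⟪v, x⟫| ≤ ‖v‖ * ‖x‖ := abs_real_inner_le_norm v x
  have hdiv : ‖x‖ / ‖v‖ ≤ 2 * ‖x‖ := by
    rw [div_le_iff₀ hpos]
    nlinarith [norm_nonneg x]
  calc |⟪x, u⟫ / ‖v‖ - ⟪v, u⟫ * ⟪v, x⟫ / ‖v‖ ^ 3|
      ≤ |⟪x, u⟫ / ‖v‖| + |⟪v, u⟫ * ⟪v, x⟫ / ‖v‖ ^ 3| := abs_sub _ _
    _ = |⟪x, u⟫| / ‖v‖ + |⟪v, u⟫| * |⟪v, x⟫| / ‖v‖ ^ 3 := by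
        simp only [abs_div, abs_mul, abs_pow, abs_norm]
    _ ≤ ‖x‖ / ‖v‖ + ‖v‖ * (‖v‖ * ‖x‖) / ‖v‖ ^ 3 := by gcongr
    _ = ‖x‖ / ‖v‖ + ‖x‖ / ‖v‖ := by
        congr 1
        field_simp
    _ ≤ 4 * ‖x‖ := by linarith

theorem half_le_norm_add_smul {E : Type*} [NormedAddCommGroup E] [NormedSpace ℝ E]
    {w x : E} {M η : ℝ} (hw : ‖w‖ = 1) (hM : 0 < M) (hx : ‖x‖ ≤ M)
    (hη : |η| ≤ 1 / (2 * M)) : 1 / 2 ≤ ‖w + η • x‖ := by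
  have h₁ : ‖η • x‖ ≤ 1 / 2 := by
    rw [norm_smul, Real.norm_eq_abs]
    calc |η| * ‖x‖ ≤ 1 / (2 * M) * M := by gcongr
      _ = 1 / 2 := by field_simp
  have h₂ : ‖w‖ - ‖η • x‖ ≤ ‖w + η • x‖ := norm_sub_le_norm_add w (η • x)
  linarith

/-- For unit vectors `wbar, wt` and a bounded random example `X`,
the expected gain in cosine similarity after one (unprojected-then-renormalized)
hinge-loss SGD step,
`Δ(η) = E[1_{⟪X, wt⟫ ≤ 1} (⟪wt + ηX, wbar⟫/‖wt + ηX‖ - ⟪wt, wbar⟫)]`,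
is differentiable at `η = 0` with
`Δ'(0) = E[1_{⟪X, wt⟫ ≤ 1} (⟪X, wbar⟫ - ⟪X, wt⟫·⟪wt, wbar⟫)]`. -/
theorem stmt13 {E : Type*} [NormedAddCommGroup E] [InnerProductSpace ℝ E]
    {Ω : Type*} [MeasureSpace Ω] [IsProbabilityMeasure (volume : Measure Ω)]
    (wbar wt : E) (hwbar : ‖wbar‖ = 1) (hwt : ‖wt‖ = 1)
    (M : ℝ) (hM : 0 < M) (X : Ω → E)
    (hXm : AEStronglyMeasurable X volume)
    (hXb : ∀ᵐ ω, ‖X ω‖ ≤ M) :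
    HasDerivAt (fun η : ℝ => ∫ ω,
        if ⟪X ω, wt⟫ ≤ 1 then ⟪wt + η • X ω, wbar⟫ / ‖wt + η • X ω‖ - ⟪wt, wbar⟫ else 0)
      (∫ ω, if ⟪X ω, wt⟫ ≤ 1 then ⟪X ω, wbar⟫ - ⟪X ω, wt⟫ * ⟪wt, wbar⟫ else 0) 0 := by
  have hinner (u : E) : AEStronglyMeasurable (fun ω => ⟪X ω, u⟫) volume :=
    hXm.inner aestronglyMeasurable_const
  have hset : NullMeasurableSet {ω | ⟪X ω, wt⟫ ≤ 1} (volume : Measure Ω) :=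
    nullMeasurableSet_le (hinner wt).aemeasurable aemeasurable_const
  have hite {f : Ω → ℝ} (hf : AEStronglyMeasurable f volume) :
      AEStronglyMeasurable (fun ω => if ⟪X ω, wt⟫ ≤ 1 then f ω else 0) volume :=
    hf.indicator₀ hset
  have hmeas (η : ℝ) : AEStronglyMeasurable (fun ω => if ⟪X ω, wt⟫ ≤ 1 then
      ⟪wt + η • X ω, wbar⟫ / ‖wt + η • X ω‖ - ⟪wt, wbar⟫ else 0) volume := by
    have hv : AEStronglyMeasurable (fun ω => wt + η • X ω) volume :=
      aestronglyMeasurable_const.add (hXm.const_smul η)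
    have hvu : AEStronglyMeasurable (fun ω => ⟪wt + η • X ω, wbar⟫) volume :=
      hv.inner aestronglyMeasurable_const
    exact hite ((hvu.aemeasurable.div
      hv.norm.aemeasurable).aestronglyMeasurable.sub aestronglyMeasurable_const)
  let F' : ℝ → Ω → ℝ := fun η ω => if ⟪X ω, wt⟫ ≤ 1 then
    ⟪X ω, wbar⟫ / ‖wt + η • X ω‖ -
      ⟪wt + η • X ω, wbar⟫ * ⟪wt + η • X ω, X ω⟫ / ‖wt + η • X ω‖ ^ 3 else 0
  have hF'_zero : F' 0 = fun ω => if ⟪X ω, wt⟫ ≤ 1 then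
      ⟪X ω, wbar⟫ - ⟪X ω, wt⟫ * ⟪wt, wbar⟫ else 0 := by
    funext ω
    simp [F', hwt, real_inner_comm, mul_comm]
  rw [← hF'_zero]
  have hball {η : ℝ} (hη : η ∈ Metric.ball (0 : ℝ) (1 / (2 * M))) : |η| ≤ 1 / (2 * M) := by
    simpa using (mem_ball_zero_iff.1 hη).le
  refine (hasDerivAt_integral_of_dominated_loc_of_deriv_le (bound := fun _ => 4 * M)
    (F' := F') (Metric.ball_mem_nhds (0 : ℝ) (by positivity : 0 < 1 / (2 * M)))
    (.of_forall hmeas) ?_ ?_ ?_ (integrable_const _) ?_).2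
  · simp [hwt]
  · rw [hF'_zero]
    exact hite ((hinner wbar).sub ((hinner wt).mul aestronglyMeasurable_const))
  · filter_upwards [hXb] with ω hω η hη
    by_cases h : ⟪X ω, wt⟫ ≤ 1
    · simp only [F', if_pos h, Real.norm_eq_abs]
      refine (abs_inner_div_sub_le _ _ _ hwbar
        (half_le_norm_add_smul hwt hM hω (hball hη))).trans ?_
      gcongr
    · simp only [F', if_neg h, norm_zero]
      positivity
  · filter_upwards [hXb] with ω hω η hη
    by_cases h : ⟪X ω, wt⟫ ≤ 1
    · simp only [F', if_pos h]
      refine (hasDerivAt_inner_div_norm_add_smul wt (X ω) wbar η ?_).sub_const _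
      have := half_le_norm_add_smul hwt hM hω (hball hη)
      exact norm_pos_iff.1 (by linarith)
    · simp only [F', if_neg h]
      exact hasDerivAt_const η 0
end

section
/- Let θ ∈ (0, π/2] (so sin θ > 0 and cos θ ≥ 0), and let f : ℝ → ℝ be nonnegative and measurable with ∫_ℝ (1 + |t|)f(t) dt < ∞. Define B(Ψ) = (Ψ − 1)·cos θ/sin θ + 1/sin θ and G(Ψ) = ∫_{−∞}^{B(Ψ)} [(1 − Ψ)sin²θ − t·sin θ·cos θ]·f(t) dt. Then G is monotonically nonincreasing on [1 − cos θ, ∞): for all 1 − cos θ ≤ Ψ₁ ≤ Ψ₂, G(Ψ₂) ≤ G(Ψ₁). (When cos θ = 0 the conclusion holds on all of ℝ.) -/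
open MeasureTheory

/-- Integrals of linear functions against `f` are defined under a first-moment condition. -/
theorem integrable_affine_mul {f : ℝ → ℝ} (hfm : Measurable f)
    (hfi : Integrable (fun t => (1 + |t|) * f t)) (a b : ℝ) :
    Integrable (fun t => (a - t * b) * f t) := by
  refine (hfi.const_mul (|a| + |b|)).mono (by fun_prop) (Filter.Eventually.of_forall fun t => ?_)
  have h : |a - t * b| ≤ (|a| + |b|) * (1 + |t|) := by
    have h₁ := abs_sub a (t * b)
    rw [abs_mul] at h₁
    nlinarith [mul_nonneg (abs_nonneg a) (abs_nonneg t), abs_nonneg b]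
  have h' : |(|a| + |b|) * (1 + |t|)| = (|a| + |b|) * (1 + |t|) := abs_of_nonneg (by positivity)
  simp only [Real.norm_eq_abs, ← mul_assoc]
  rw [abs_mul, abs_mul _ (f t), h']
  gcongr

/-- Lowering the integrand on `Iic a` and extending it by nonpositive values to `Iic b`
lowers the integral. -/
theorem setIntegral_Iic_le_of_le_of_nonpos {g h : ℝ → ℝ} {a b : ℝ} (hab : a ≤ b)
    (hg : Integrable g) (hh : Integrable h) (hle : ∀ t ≤ a, h t ≤ g t)
    (hnonpos : ∀ t, a < t → t ≤ b → h t ≤ 0) :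
    ∫ t in Set.Iic b, h t ≤ ∫ t in Set.Iic a, g t := by
  rw [← integral_indicator measurableSet_Iic, ← integral_indicator measurableSet_Iic]
  refine integral_mono (hh.indicator measurableSet_Iic) (hg.indicator measurableSet_Iic) fun t => ?_
  simp only [Set.indicator_apply, Set.mem_Iic]
  split_ifs with h₁ h₂ h₂
  · exact hle t h₂
  · exact hnonpos t (not_le.mp h₂) h₁
  · exact absurd (h₂.trans hab) h₁
  · exact le_rfl

/-- (Theorem 5 of the paper, cases 1 and 2.) For `θ ∈ (0, π/2]`
(so `sin θ > 0`, `cos θ ≥ 0`), the first-order expected convergence rate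
`G(Ψ) = ∫_{-∞}^{B(Ψ)} [(1 - Ψ) sin²θ - t sin θ cos θ] f(t) dt`, with
`B(Ψ) = (Ψ - 1) cos θ/sin θ + 1/sin θ`, is monotonically nonincreasing on
`[1 - cos θ, ∞)`; when `cos θ = 0` it is nonincreasing on all of `ℝ`. -/
theorem stmt14 (θ : ℝ) (hθ : θ ∈ Set.Ioc 0 (Real.pi / 2))
    (f : ℝ → ℝ) (hf : ∀ t, 0 ≤ f t) (hfm : Measurable f)
    (hfi : Integrable (fun t => (1 + |t|) * f t))
    (B G : ℝ → ℝ)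
    (hB : ∀ Ψ : ℝ, B Ψ = (Ψ - 1) * Real.cos θ / Real.sin θ + 1 / Real.sin θ)
    (hG : ∀ Ψ : ℝ, G Ψ = ∫ t in Set.Iic (B Ψ),
      ((1 - Ψ) * Real.sin θ ^ 2 - t * Real.sin θ * Real.cos θ) * f t) :
    AntitoneOn G (Set.Ici (1 - Real.cos θ)) ∧
    (Real.cos θ = 0 → Antitone G) := by
  have hs : 0 < Real.sin θ :=
    Real.sin_pos_of_pos_of_lt_pi hθ.1 (by linarith [hθ.2, Real.pi_pos])
  have hc : 0 ≤ Real.cos θ :=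
    Real.cos_nonneg_of_neg_pi_div_two_le_of_le (by linarith [hθ.1, Real.pi_pos]) hθ.2
  have hsc := Real.sin_sq_add_cos_sq θ
  have hBmono : Monotone B := fun x y hxy => by
    rw [hB, hB]
    gcongr
  have hint : ∀ Ψ : ℝ, Integrable
      (fun t => ((1 - Ψ) * Real.sin θ ^ 2 - t * Real.sin θ * Real.cos θ) * f t) := fun Ψ => by
    simpa only [mul_assoc] using integrable_affine_mul hfm hfi
      ((1 - Ψ) * Real.sin θ ^ 2) (Real.sin θ * Real.cos θ)
  have hle : ∀ {x y : ℝ}, x ≤ y → ∀ t : ℝ,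
      (1 - y) * Real.sin θ ^ 2 - t * Real.sin θ * Real.cos θ ≤
        (1 - x) * Real.sin θ ^ 2 - t * Real.sin θ * Real.cos θ := fun hxy t => by
    gcongr
  constructor
  · intro x hx y _ hxy
    rw [hG, hG]
    refine setIntegral_Iic_le_of_le_of_nonpos (hBmono hxy) (hint x) (hint y)
      (fun t _ => mul_le_mul_of_nonneg_right (hle hxy t) (hf t))
      fun t ht _ => mul_nonpos_of_nonpos_of_nonneg ((hle hxy t).trans ?_) (hf t)
    have hBs : B x * Real.sin θ = (x - 1) * Real.cos θ + 1 := by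
      rw [hB]
      field_simp
    have htB : B x * Real.sin θ * Real.cos θ ≤ t * Real.sin θ * Real.cos θ := by gcongr
    rw [hBs] at htB
    have hx' : 1 - Real.cos θ ≤ x := hx
    linear_combination htB + hx' + (1 - x) * hsc
  · intro hc0 x y hxy
    have hBeq : B x = B y := by simp [hB, hc0]
    rw [hG, hG]
    exact setIntegral_Iic_le_of_le_of_nonpos (hBmono hxy) (hint x) (hint y)
      (fun t _ => mul_le_mul_of_nonneg_right (hle hxy t) (hf t))
      fun t h₁ h₂ => absurd (h₂.trans_eq hBeq.symm) (not_le.mpr h₁)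
end

section
/- Let θ ∈ [π/2, π) (so sin θ > 0 and cos θ ≤ 0), and let f : ℝ → ℝ be nonnegative and measurable with ∫_ℝ (1 + |t|)f(t) dt < ∞. Define B(Ψ) = (Ψ − 1)·cos θ/sin θ + 1/sin θ and G(Ψ) = ∫_{−∞}^{B(Ψ)} [(1 − Ψ)sin²θ − t·sin θ·cos θ]·f(t) dt. Then G is monotonically nonincreasing on (−∞, 1 − cos θ]: for all Ψ₁ ≤ Ψ₂ ≤ 1 − cos θ, G(Ψ₂) ≤ G(Ψ₁). -/
open MeasureTheory

/-- (Theorem 5 of the paper, case 3.) For `θ ∈ [π/2, π)`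
(so `sin θ > 0`, `cos θ ≤ 0`), the first-order expected convergence rate
`G(Ψ) = ∫_{-∞}^{B(Ψ)} [(1 - Ψ) sin²θ - t sin θ cos θ] f(t) dt`, with
`B(Ψ) = (Ψ - 1) cos θ/sin θ + 1/sin θ`, is monotonically nonincreasing on
`(-∞, 1 - cos θ]`. -/
theorem stmt15 (θ : ℝ) (hθ : θ ∈ Set.Ico (Real.pi / 2) Real.pi)
    (f : ℝ → ℝ) (hf : ∀ t, 0 ≤ f t) (hfm : Measurable f)
    (hfi : Integrable (fun t => (1 + |t|) * f t))
    (B G : ℝ → ℝ)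
    (hB : ∀ Ψ : ℝ, B Ψ = (Ψ - 1) * Real.cos θ / Real.sin θ + 1 / Real.sin θ)
    (hG : ∀ Ψ : ℝ, G Ψ = ∫ t in Set.Iic (B Ψ),
      ((1 - Ψ) * Real.sin θ ^ 2 - t * Real.sin θ * Real.cos θ) * f t) :
    AntitoneOn G (Set.Iic (1 - Real.cos θ)) := by
  obtain ⟨h₁, h₂⟩ := hθ
  have hs : 0 < Real.sin θ := Real.sin_pos_of_pos_of_lt_pi (by linarith [Real.pi_pos]) h₂
  have hc : Real.cos θ ≤ 0 :=
    Real.cos_nonpos_of_pi_div_two_le_of_le h₁ (by linarith [Real.pi_pos])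
  have hsc := Real.sin_sq_add_cos_sq θ
  have hBs : ∀ Ψ, B Ψ * Real.sin θ = (Ψ - 1) * Real.cos θ + 1 := fun Ψ => by
    rw [hB]
    field_simp
  generalize Real.sin θ = s at *
  generalize Real.cos θ = c at *
  have hint : ∀ Ψ : ℝ, Integrable (fun t => ((1 - Ψ) * s ^ 2 - t * s * c) * f t) := fun Ψ => by
    refine (hfi.const_mul (|(1 - Ψ) * s ^ 2| + |s * c|)).mono'
      (by fun_prop) (Filter.Eventually.of_forall fun t => ?_)
    rw [Real.norm_eq_abs, abs_mul, abs_of_nonneg (hf t), ← mul_assoc]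
    refine mul_le_mul_of_nonneg_right ?_ (hf t)
    calc |(1 - Ψ) * s ^ 2 - t * s * c|
        ≤ |(1 - Ψ) * s ^ 2| + |t * s * c| := abs_sub _ _
      _ = |(1 - Ψ) * s ^ 2| + |t| * |s * c| := by rw [mul_assoc t, abs_mul t]
      _ ≤ (|(1 - Ψ) * s ^ 2| + |s * c|) * (1 + |t|) := by
        nlinarith [abs_nonneg t, abs_nonneg (s * c), abs_nonneg ((1 - Ψ) * s ^ 2),
          mul_nonneg (abs_nonneg t) (abs_nonneg ((1 - Ψ) * s ^ 2))]
  intro a _ b hb hab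
  rw [Set.mem_Iic] at hb
  have hBab : B b ≤ B a := by
    refine le_of_mul_le_mul_right ?_ hs
    rw [hBs, hBs]
    nlinarith
  rw [hG, hG, ← integral_indicator measurableSet_Iic, ← integral_indicator measurableSet_Iic]
  refine integral_mono ((hint b).indicator measurableSet_Iic)
    ((hint a).indicator measurableSet_Iic) fun t => ?_
  have hle : (1 - b) * s ^ 2 ≤ (1 - a) * s ^ 2 :=
    mul_le_mul_of_nonneg_right (by linarith) (sq_nonneg s)
  by_cases htb : t ≤ B b
  · simp only [Set.indicator, Set.mem_Iic, htb, htb.trans hBab, if_true]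
    exact mul_le_mul_of_nonneg_right (by linarith) (hf t)
  · simp only [Set.indicator, Set.mem_Iic, htb, if_false]
    split_ifs with hta
    · refine mul_nonneg ?_ (hf t)
      have hts : (b - 1) * c + 1 ≤ t * s :=
        hBs b ▸ mul_le_mul_of_nonneg_right (not_le.mp htb).le hs.le
      have hmul := mul_le_mul_of_nonpos_right hts hc
      have hend : (1 - b) * s ^ 2 - ((b - 1) * c + 1) * c = 1 - b - c := by
        linear_combination (1 - b) * hsc
      linarith
    · exact le_rfl
end

section
/- Let θ ∈ (0, π/2) (so cos θ > 0 and sin θ > 0). Then there exist a nonnegative measurable function f : ℝ → ℝ with ∫_ℝ f(t) dt = 1 and ∫_ℝ |t|f(t) dt < ∞, and real numbers Ψ₁, Ψ₂ with 0 < Ψ₁ < Ψ₂ < 1 − cos θ, such that G(Ψ₁) < G(Ψ₂), where B(Ψ) = (Ψ − 1)·cos θ/sin θ + 1/sin θ and G(Ψ) = ∫_{−∞}^{B(Ψ)} [(1 − Ψ)sin²θ − t·sin θ·cos θ]·f(t) dt. In particular, G need not be monotonically nonincreasing on the interval [0, 1 − cos θ]. -/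
open MeasureTheory

/-- The density of the uniform distribution on `(a, b]`. -/
noncomputable def uniformDensity (a b : ℝ) : ℝ → ℝ :=
  (Set.Ioc a b).indicator fun _ => (b - a)⁻¹

theorem uniformDensity_nonneg {a b : ℝ} (hab : a < b) (t : ℝ) : 0 ≤ uniformDensity a b t :=
  Set.indicator_nonneg (fun _ _ => inv_nonneg.2 (sub_nonneg.2 hab.le)) t

theorem uniformDensity_of_notMem {a b t : ℝ} (ht : t ∉ Set.Ioc a b) : uniformDensity a b t = 0 :=
  Set.indicator_of_notMem ht _

theorem measurable_uniformDensity (a b : ℝ) : Measurable (uniformDensity a b) :=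
  measurable_const.indicator measurableSet_Ioc

theorem integrable_mul_uniformDensity (a b : ℝ) {g : ℝ → ℝ} (hg : Continuous g) :
    Integrable fun t => g t * uniformDensity a b t := by
  have h : (fun t => g t * uniformDensity a b t) =
      (Set.Ioc a b).indicator fun t => g t * (b - a)⁻¹ := by
    ext t
    by_cases ht : t ∈ Set.Ioc a b <;> simp [uniformDensity, ht]
  rw [h, integrable_indicator_iff measurableSet_Ioc]
  exact (hg.mul continuous_const).integrableOn_Ioc

theorem integrable_uniformDensity (a b : ℝ) : Integrable (uniformDensity a b) := by
  simpa using integrable_mul_uniformDensity a b (continuous_const (y := (1 : ℝ)))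

theorem integral_uniformDensity {a b : ℝ} (hab : a < b) : ∫ t, uniformDensity a b t = 1 := by
  have h : b - a ≠ 0 := (sub_pos.2 hab).ne'
  simp [uniformDensity, integral_indicator measurableSet_Ioc, hab.le, h]

theorem setIntegral_Iic_mul_uniformDensity_eq_zero (a b : ℝ) (g : ℝ → ℝ) :
    ∫ t in Set.Iic a, g t * uniformDensity a b t = 0 :=
  setIntegral_eq_zero_of_forall_eq_zero fun t ht => by
    rw [uniformDensity_of_notMem fun h => h.1.not_ge ht, mul_zero]

theorem le_setIntegral_Iic_mul_uniformDensity {a b δ : ℝ} (hab : a < b) {g : ℝ → ℝ}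
    (hg : Continuous g) (h : ∀ t ≤ b, δ ≤ g t) :
    δ ≤ ∫ t in Set.Iic b, g t * uniformDensity a b t := by
  have h₁ : ∫ t in Set.Iic b, uniformDensity a b t = 1 := by
    rw [← integral_uniformDensity hab]
    exact setIntegral_eq_integral_of_forall_compl_eq_zero fun t ht =>
      uniformDensity_of_notMem fun h => ht h.2
  calc
    δ = ∫ t in Set.Iic b, δ * uniformDensity a b t := by
      rw [integral_const_mul, h₁, mul_one]
    _ ≤ _ := setIntegral_mono_on
      (integrable_mul_uniformDensity a b continuous_const).integrableOn
      (integrable_mul_uniformDensity a b hg).integrableOn measurableSet_Iic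
      fun t ht => mul_le_mul_of_nonneg_right (h t ht) (uniformDensity_nonneg hab t)

/-- Up to the hinge threshold the integrand of the convergence rate is at least its value there. -/
theorem sub_cos_le_integrand {θ Ψ t : ℝ} (hs : 0 < Real.sin θ) (hc : 0 < Real.cos θ)
    (ht : t ≤ (Ψ - 1) * Real.cos θ / Real.sin θ + 1 / Real.sin θ) :
    1 - Ψ - Real.cos θ ≤ (1 - Ψ) * Real.sin θ ^ 2 - t * Real.sin θ * Real.cos θ := by
  rw [← add_div, le_div_iff₀ hs] at ht
  have h := mul_le_mul_of_nonneg_right ht hc.le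
  rw [Real.sin_sq]
  linarith

/-- (Theorem 6 of the paper.) For any `θ ∈ (0, π/2)` there exist a
probability density `f` with finite first moment and difficulty scores
`0 < Ψ₁ < Ψ₂ < 1 - cos θ` such that `G(Ψ₁) < G(Ψ₂)`: the first-order expected
convergence rate `G` need not be monotonically nonincreasing on `[0, 1 - cos θ]`. -/
theorem stmt16 (θ : ℝ) (hθ : θ ∈ Set.Ioo 0 (Real.pi / 2)) :
    ∃ (f : ℝ → ℝ) (Ψ₁ Ψ₂ : ℝ),
      (∀ t, 0 ≤ f t) ∧ Measurable f ∧
      Integrable f ∧ (∫ t, f t) = 1 ∧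
      Integrable (fun t => |t| * f t) ∧
      0 < Ψ₁ ∧ Ψ₁ < Ψ₂ ∧ Ψ₂ < 1 - Real.cos θ ∧
      (∫ t in Set.Iic ((Ψ₁ - 1) * Real.cos θ / Real.sin θ + 1 / Real.sin θ),
          ((1 - Ψ₁) * Real.sin θ ^ 2 - t * Real.sin θ * Real.cos θ) * f t) <
        (∫ t in Set.Iic ((Ψ₂ - 1) * Real.cos θ / Real.sin θ + 1 / Real.sin θ),
          ((1 - Ψ₂) * Real.sin θ ^ 2 - t * Real.sin θ * Real.cos θ) * f t) := by
  have hs : 0 < Real.sin θ :=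
    Real.sin_pos_of_pos_of_lt_pi hθ.1 (by linarith [hθ.2, Real.pi_pos])
  have hc : 0 < Real.cos θ := Real.cos_pos_of_mem_Ioo ⟨by linarith [hθ.1, hθ.2], hθ.2⟩
  have hc₁ : Real.cos θ < 1 := by nlinarith [Real.sin_sq_add_cos_sq θ]
  obtain ⟨Ψ₁, h₀, h₁⟩ := exists_between (sub_pos.2 hc₁)
  obtain ⟨Ψ₂, h₁₂, h₂⟩ := exists_between h₁
  have hB : (Ψ₁ - 1) * Real.cos θ / Real.sin θ + 1 / Real.sin θ <
      (Ψ₂ - 1) * Real.cos θ / Real.sin θ + 1 / Real.sin θ := by gcongr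
  refine ⟨uniformDensity _ _, Ψ₁, Ψ₂, uniformDensity_nonneg hB, measurable_uniformDensity _ _,
    integrable_uniformDensity _ _, integral_uniformDensity hB,
    integrable_mul_uniformDensity _ _ continuous_abs, h₀, h₁₂, h₂, ?_⟩
  rw [setIntegral_Iic_mul_uniformDensity_eq_zero]
  exact (by linarith : 0 < 1 - Ψ₂ - Real.cos θ).trans_le
    (le_setIntegral_Iic_mul_uniformDensity hB (by fun_prop) fun t ht =>
      sub_cos_le_integrand hs hc ht)
end

section
/- Let E be a real inner product space, let w̄, w_t ∈ E be unit vectors with ⟪w̄, w_t⟫ = cos θ where cos θ ≥ 0, and fix Ψ ∈ ℝ. For each x ∈ E with ⟪x, w̄⟫ = 1 − Ψ and ⟪x, w_t⟫ = 1 − Υ, the derivative at η = 0 of the cosine similarity φ(η) = ⟪w_t + ηx, w̄⟫/‖w_t + ηx‖ equals (1 − Ψ) − (1 − Υ)·cos θ. Consequently, at fixed global difficulty Ψ, this first-order convergence rate is monotonically nondecreasing as a function of the local difficulty Υ. -/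
open scoped RealInnerProductSpace

/-- The derivative at `0` of the cosine similarity along the line `w + η • x` through a unit
vector `w`. -/
theorem hasDerivAt_cosine_similarity {E : Type*} [NormedAddCommGroup E] [InnerProductSpace ℝ E]
    (v w x : E) (hw : ‖w‖ = 1) :
    HasDerivAt (fun η : ℝ => ⟪w + η • x, v⟫ / ‖w + η • x‖) (⟪x, v⟫ - ⟪x, w⟫ * ⟪w, v⟫) 0 := by
  have hline : HasDerivAt (fun η : ℝ => w + η • x) x 0 := by
    simpa using ((hasDerivAt_id (0 : ℝ)).smul_const x).const_add w
  have hinner : HasDerivAt (fun η : ℝ => ⟪w + η • x, v⟫) ⟪x, v⟫ 0 := by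
    simpa using hline.inner ℝ (hasDerivAt_const (0 : ℝ) v)
  have hnorm : HasDerivAt (fun η : ℝ => ‖w + η • x‖) ⟪x, w⟫ 0 := by
    have h := hline.norm_sq.sqrt (by simp [hw])
    simpa [hw, real_inner_comm] using h
  refine (hinner.div hnorm (by simp [hw])).congr_deriv ?_
  simp [hw, mul_comm]

/-- (Theorem 7 of the paper.) For unit hypotheses `wbar, wt` with
`⟪wbar, wt⟫ = cos θ ≥ 0` and fixed global difficulty `Ψ`: for every example `x` with
`⟪x, wbar⟫ = 1 - Ψ` and local difficulty `Υ` (i.e. `⟪x, wt⟫ = 1 - Υ`), the derivative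
at `η = 0` of the cosine similarity `φ(η) = ⟪wt + ηx, wbar⟫/‖wt + ηx‖` equals
`(1 - Ψ) - (1 - Υ) cos θ`; consequently this first-order convergence rate is
monotonically nondecreasing in `Υ`. -/
theorem stmt17 {E : Type*} [NormedAddCommGroup E] [InnerProductSpace ℝ E]
    (wbar wt : E) (hwbar : ‖wbar‖ = 1) (hwt : ‖wt‖ = 1)
    (θ : ℝ) (hcos : ⟪wbar, wt⟫ = Real.cos θ) (hcosnn : 0 ≤ Real.cos θ)
    (Ψ : ℝ) :
    (∀ (x : E) (Υ : ℝ), ⟪x, wbar⟫ = 1 - Ψ → ⟪x, wt⟫ = 1 - Υ →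
      HasDerivAt (fun η : ℝ => ⟪wt + η • x, wbar⟫ / ‖wt + η • x‖)
        ((1 - Ψ) - (1 - Υ) * Real.cos θ) 0) ∧
    Monotone (fun Υ : ℝ => (1 - Ψ) - (1 - Υ) * Real.cos θ) := by
  refine ⟨fun x Υ hxbar hxt => ?_, fun a b hab => ?_⟩
  · have h := hasDerivAt_cosine_similarity wbar wt x hwt
    rwa [hxbar, hxt, real_inner_comm, hcos] at h
  · have := mul_le_mul_of_nonneg_right hab hcosnn
    simp only
    linarith
end
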